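/- Let t' ≥ 5/2 be a real number, let G be a t'-tough graph on n ≥ 3 vertices, and let x and y be two non-adjacent vertices of G with d(x) + d(y) ≥ n − (2t'+1)/3. Then G is Hamiltonian if and only if the graph obtained from G by adding the edge xy is Hamiltonian. -/

import Mathlib

open SimpleGraph

/-- A graph `G` is `t`-tough if for every set `S` of vertices such that `G - S` is
disconnected, `t * c(G - S) ≤ |S|`, where `c` counts connected components. -/
def Tough {V : Type*} [Fintype V] (t : ℝ) (G : SimpleGraph V) : Prop :=
  ∀ S : Finset V, ¬ (G.induce ((↑S : Set V)ᶜ)).Connected →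
    t * (Nat.card (G.induce ((↑S : Set V)ᶜ)).ConnectedComponent) ≤ S.card

def segU (a b : ℕ) : List ℕ := List.range' a (b - a)
def segD (a b : ℕ) : List ℕ := (segU a b).reverse

theorem dn_cycles (N : ℕ) (r : ℕ → ℕ → Prop) (hs : ∀ i j, r i j → r j i)
  (hp : ∀ i, i < N → r i (i+1))
  (hcyc : ∀ l : List ℕ, l.Nodup → l.length = N + 1 → (∀ i ∈ l, i ≤ N) → l.IsChain r →
     (∀ a ∈ l.head?, ∀ b ∈ l.getLast?, r b a) → False) :
  (∀ i, i < N → r 0 (i+1) → r N i → False) ∧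
  (∀ s q, s + 1 < q → q ≤ N → r s q → r 0 (s+1) → r N (q-1) → False) ∧
  (∀ q s, q < s → s < N → r q s → r N (q+1) → r 0 (s+1) → False) ∧
  (∀ w j, 1 ≤ w → w + 2 ≤ j → j ≤ N → r w j → r N (w-1) → r 0 (j-1) → False) ∧
  (∀ l i s, l < i → i + 2 ≤ s → s ≤ N → r l (i+1) → r s i → r 0 (l+1) → r N (s-1) → False) := by
  have upc : ∀ a b, b ≤ N + 1 → (segU a b).IsChain r := by
    intro a b hb
    rw [List.isChain_iff_getElem]
    intro i hi
    simp [segU] at hi ⊢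
    rw [← add_assoc]
    apply hp; omega
  have dnc : ∀ a b, b ≤ N + 1 → (segD a b).IsChain r := by
    intro a b hb
    rw [segD, List.isChain_reverse]
    exact (upc a b hb).imp (fun _ _ h => hs _ _ h)
  have mu : ∀ a b i, i ∈ segU a b ↔ a ≤ i ∧ i < b := by
    intro a b i; simp [segU]; omega
  have md : ∀ a b i, i ∈ segD a b ↔ a ≤ i ∧ i < b := by
    intro a b i; simp [segD, mu]
  have nu : ∀ a b, (segU a b).Nodup := fun a b => List.nodup_range'
  have nd : ∀ a b, (segD a b).Nodup := fun a b => by simp [segD, nu]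
  have lu : ∀ a b, (segU a b).length = b - a := by simp [segU]
  have ld : ∀ a b, (segD a b).length = b - a := by simp [segD, lu]
  have hu : ∀ a b, a < b → (segU a b).head? = some a := by
    intro a b h; simp [segU, List.head?_range']; omega
  have gu : ∀ a b, a < b → (segU a b).getLast? = some (b-1) := by
    intro a b h; simp [segU, List.getLast?_range']; omega
  have hd : ∀ a b, a < b → (segD a b).head? = some (b-1) := by
    intro a b h; simp [segD, gu _ _ h]
  have gd : ∀ a b, a < b → (segD a b).getLast? = some a := by
    intro a b h; simp [segD, hu _ _ h]
  refine ⟨?_, ?_, ?_, ?_, ?_⟩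
  · intro i hi h1 h2
    apply hcyc (segU 0 (i+1) ++ segD (i+1) (N+1))
    · simp only [List.nodup_append, nu, nd, mu, md, true_and]; omega
    · simp only [List.length_append, lu, ld]; omega
    · simp only [List.mem_append, mu, md]; omega
    · simp only [List.isChain_append]
      refine ⟨upc _ _ (by omega), dnc _ _ (by omega), ?_⟩
      rw [gu _ _ (by omega), hd _ _ (by omega)]
      simpa using hs _ _ h2
    · rw [List.head?_append, List.getLast?_append, hu _ _ (by omega), gd _ _ (by omega)]
      simpa using hs _ _ h1
  · intro s q hsq hq h h1 h2
    apply hcyc (segU 0 (s+1) ++ (segU q (N+1) ++ segD (s+1) q))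
    · simp only [List.nodup_append, nu, nd, mu, md, true_and, List.mem_append]; and_intros <;> (intros; omega)
    · simp only [List.length_append, lu, ld]; omega
    · simp only [List.mem_append, mu, md]; omega
    · simp only [List.isChain_append]
      refine ⟨upc _ _ (by omega), ⟨upc _ _ (by omega), dnc _ _ (by omega), ?_⟩, ?_⟩
      · rw [gu _ _ (by omega), hd _ _ (by omega)]
        simpa using h2
      · rw [gu _ _ (by omega), List.head?_append, hu _ _ (by omega)]
        simpa using h
    · rw [List.head?_append, List.getLast?_append, List.getLast?_append, hu _ _ (by omega), gd _ _ (by omega)]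
      simpa using hs _ _ h1
  · intro q s hsq hq h h1 h2
    apply hcyc (segU 0 (q+1) ++ (segD (q+1) (s+1) ++ segD (s+1) (N+1)))
    · simp only [List.nodup_append, nu, nd, mu, md, true_and, List.mem_append]; and_intros <;> (intros; omega)
    · simp only [List.length_append, lu, ld]; omega
    · simp only [List.mem_append, mu, md]; omega
    · simp only [List.isChain_append]
      refine ⟨upc _ _ (by omega), ⟨dnc _ _ (by omega), dnc _ _ (by omega), ?_⟩, ?_⟩
      · rw [gd _ _ (by omega), hd _ _ (by omega)]
        simpa using hs _ _ h1
      · rw [gu _ _ (by omega), List.head?_append, hd _ _ (by omega)]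
        simpa using h
    · rw [List.head?_append, List.getLast?_append, List.getLast?_append, hu _ _ (by omega), gd _ _ (by omega)]
      simpa using hs _ _ h2
  · intro w j hw hwj hj h h1 h2
    apply hcyc (segU 0 w ++ (segD j (N+1) ++ segU w j))
    · simp only [List.nodup_append, nu, nd, mu, md, true_and, List.mem_append]; and_intros <;> (intros; omega)
    · simp only [List.length_append, lu, ld]; omega
    · simp only [List.mem_append, mu, md]; omega
    · simp only [List.isChain_append]
      refine ⟨upc _ _ (by omega), ⟨dnc _ _ (by omega), upc _ _ (by omega), ?_⟩, ?_⟩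
      · rw [gd _ _ (by omega), hu _ _ (by omega)]
        simpa using hs _ _ h
      · rw [gu _ _ (by omega), List.head?_append, hd _ _ (by omega)]
        simpa using hs _ _ h1
    · rw [List.head?_append, List.getLast?_append, List.getLast?_append, hu _ _ (by omega), gu _ _ (by omega)]
      simpa using hs _ _ h2
  · intro l i s hli his hsN h h1 h2 h3
    apply hcyc (segU 0 (l+1) ++ (segU (i+1) s ++ (segD s (N+1) ++ segD (l+1) (i+1))))
    · simp only [List.nodup_append, nu, nd, mu, md, true_and, List.mem_append]; and_intros <;> (intros; omega)
    · simp only [List.length_append, lu, ld]; omega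
    · simp only [List.mem_append, mu, md]; omega
    · simp only [List.isChain_append]
      refine ⟨upc _ _ (by omega), ⟨upc _ _ (by omega), ⟨dnc _ _ (by omega), dnc _ _ (by omega), ?_⟩, ?_⟩, ?_⟩
      · rw [gd _ _ (by omega), hd _ _ (by omega)]
        simpa using h1
      · rw [gu _ _ (by omega), List.head?_append, hd _ _ (by omega)]
        simpa using hs _ _ h3
      · rw [gu _ _ (by omega), List.head?_append, hu _ _ (by omega)]
        simpa using h
    · rw [List.head?_append, List.getLast?_append, List.getLast?_append, List.getLast?_append, hu _ _ (by omega), gd _ _ (by omega)]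
      simpa using hs _ _ h2

theorem core_arith (t : ℝ) (m w : ℕ) (ht : 5 / 2 ≤ t) (hm : (3 * m + 2 : ℝ) ≤ 2 * t)
    (h1 : 2 * t ≤ 2 * w + 3 * m + 1)
    (h2 : 0 < w → 2 * t ≤ w + 2 * m + 1)
    (h3 : 0 < w → t * (w + 1) ≤ 2 * w + 4 * m)
    (h4 : 0 < w → m = 1 → t * (w + 1) ≤ 2 * w + 3) : False := by
  rcases Nat.eq_zero_or_pos w with h0 | h0
  · subst h0; push_cast at h1; linarith
  specialize h2 h0
  specialize h3 h0
  specialize h4 h0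
  have hw : (1 : ℝ) ≤ w := by exact_mod_cast h0
  have e : (5/2 : ℝ) * (w + 1) ≤ t * (w + 1) := by gcongr
  rcases Nat.lt_or_ge m 2 with h | h
  · interval_cases m
    · push_cast at *; linarith
    · have := h4 rfl
      push_cast at *
      linarith
  · have hm2 : (2 : ℝ) ≤ m := by exact_mod_cast h
    have e2 : ((3 * m + 2) / 2 : ℝ) * (w + 1) ≤ t * (w + 1) := by gcongr; linarith
    nlinarith

theorem core_comb (N : ℕ) (hN : 2 ≤ N) (r : ℕ → ℕ → Prop) (t : ℝ) (ht : 5 / 2 ≤ t)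
    (hs : ∀ i j, r i j → r j i) (hirr : ∀ i, ¬ r i i)
    (hp : ∀ i, i < N → r i (i+1))
    (h0N : ¬ r 0 N)
    (K1 : ∀ i, i < N → r 0 (i+1) → r N i → False)
    (K2 : ∀ s q, s + 1 < q → q ≤ N → r s q → r 0 (s+1) → r N (q-1) → False)
    (K3 : ∀ q s, q < s → s < N → r q s → r N (q+1) → r 0 (s+1) → False)
    (K4 : ∀ w j, 1 ≤ w → w + 2 ≤ j → j ≤ N → r w j → r N (w-1) → r 0 (j-1) → False)
    (K5 : ∀ l i s, l < i → i + 2 ≤ s → s ≤ N → r l (i+1) → r s i → r 0 (l+1) → r N (s-1) → False)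
    (hT : ∀ (S T : Finset ℕ) (f : ℕ → ℕ), (∀ i ∈ T, i ≤ N) → Disjoint S T →
      Set.InjOn f (T : Set ℕ) → 2 ≤ T.card →
      (∀ i j, i ≤ N → j ≤ N → i ∉ S → j ∉ S → r i j → f i = f j) → t * T.card ≤ S.card)
    (dx dy : ℕ) 
    (hdx : ∀ T : Finset ℕ, (∀ i, i ∈ T ↔ i ≤ N ∧ r 0 i) → T.card = dx)
    (hdy : ∀ T : Finset ℕ, (∀ i, i ∈ T ↔ i ≤ N ∧ r N i) → T.card = dy)
    (hdeg : ((N + 1 : ℕ) : ℝ) - (2 * t + 1) / 3 ≤ dx + dy) : False := by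
  classical
  set A := (Finset.range N).filter (fun i => r 0 (i+1)) with hA
  set B := (Finset.range N).filter (fun i => r N i) with hB
  set C := (Finset.range N).filter (fun i => ¬ r 0 (i+1) ∧ ¬ r N i) with hC
  set W := (Finset.range N).filter (fun i => 1 ≤ i ∧ r 0 (i+1) ∧ r N (i-1)) with hW
  set U := (Finset.range N).filter (fun i => 1 ≤ i ∧ ¬ r 0 i ∧ ¬ r N i) with hU
  have mA : ∀ i, i ∈ A ↔ i < N ∧ r 0 (i+1) := by simp [hA]
  have mB : ∀ i, i ∈ B ↔ i < N ∧ r N i := by simp [hB]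
  have mC : ∀ i, i ∈ C ↔ i < N ∧ ¬ r 0 (i+1) ∧ ¬ r N i := by simp [hC]
  have mW : ∀ i, i ∈ W ↔ i < N ∧ 1 ≤ i ∧ r 0 (i+1) ∧ r N (i-1) := by simp [hW]
  have mU : ∀ i, i ∈ U ↔ i < N ∧ 1 ≤ i ∧ ¬ r 0 i ∧ ¬ r N i := by simp [hU]
  clear_value A B C W U
  have hAc : A.card = dx := by
    rw [← hdx (A.image (· + 1)), Finset.card_image_of_injective _ (add_left_injective 1)]
    intro i
    simp only [Finset.mem_image, mA]
    constructor
    · rintro ⟨j, ⟨h1, h2⟩, rfl⟩; exact ⟨h1, h2⟩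
    · rintro ⟨h1, h2⟩
      rcases i with _ | i
      · exact absurd h2 (hirr 0)
      · exact ⟨i, ⟨h1, h2⟩, rfl⟩
  have hBc : B.card = dy := by
    apply hdy
    intro i
    rw [mB]
    constructor
    · rintro ⟨h1, h2⟩; exact ⟨h1.le, h2⟩
    · rintro ⟨h1, h2⟩
      refine ⟨lt_of_le_of_ne h1 ?_, h2⟩
      rintro rfl; exact hirr _ h2
  have hcard : A.card + B.card + C.card = N := by
    rw [← Finset.card_union_of_disjoint, ← Finset.card_union_of_disjoint]
    · conv_rhs => rw [← Finset.card_range N]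
      congr 1
      ext i
      simp only [Finset.mem_union, mA, mB, mC, Finset.mem_range]
      tauto
    · rw [Finset.disjoint_left]
      intro i; simp only [Finset.mem_union, mA, mB, mC]; tauto
    · rw [Finset.disjoint_left]
      intro i; simp only [mA, mB]
      rintro ⟨h1, h2⟩ ⟨_, h3⟩; exact K1 i h1 h2 h3
  -- W ⊆ U
  have WU : ∀ i ∈ W, i ∈ U := by
    intro i hi
    rw [mW] at hi; rw [mU]
    obtain ⟨h1, h2, h3, h4⟩ := hi
    refine ⟨h1, h2, fun h => ?_, fun h => K1 i h1 h3 h⟩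
    apply K1 (i-1) (by omega) _ h4
    rwa [Nat.sub_add_cancel h2]
  have hUc : U.card ≤ W.card + 2 * C.card := by
    have : U ⊆ W ∪ (C ∪ C.image (· + 1)) := by
      intro i hi
      rw [mU] at hi
      obtain ⟨h1, h2, h3, h4⟩ := hi
      obtain ⟨j, rfl⟩ : ∃ j, i = j + 1 := ⟨i - 1, by omega⟩
      simp only [Finset.mem_union, mW, mC, Finset.mem_image]
      by_cases ha : r 0 (j+1+1)
      · by_cases hb : r N j
        · left; exact ⟨h1, h2, ha, hb⟩
        · right; right; exact ⟨j, ⟨by omega, h3, hb⟩, rfl⟩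
      · right; left; exact ⟨h1, ha, h4⟩
    have h1 := Finset.card_le_card this
    have h2 := Finset.card_union_le W (C ∪ C.image (· + 1))
    have h3 := Finset.card_union_le C (C.image (· + 1))
    have h4 : (C.image (· + 1)).card ≤ C.card := Finset.card_image_le
    omega
  -- neighbours of W
  have NL : ∀ w ∈ W, ∀ j, j ≤ N → r w j →
      (∃ u ∈ U, w ≤ u ∧ j = u + 1) ∨ (∃ u ∈ U, u ≤ w ∧ j = u - 1) := by
    intro w hw j hj h
    have hwU := WU w hw
    rw [mW] at hw
    obtain ⟨h1, h2, h3, h4⟩ := hw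
    rcases lt_trichotomy w j with hlt | rfl | hlt
    · left
      refine ⟨j - 1, ?_, by omega, by omega⟩
      by_cases hj1 : j = w + 1
      · subst hj1; simpa using hwU
      rw [mU]
      refine ⟨by omega, by omega, fun h5 => K4 w j h2 (by omega) hj h h4 h5,
        fun h5 => K2 w j (by omega) hj h h3 h5⟩
    · exact absurd h (hirr _)
    · right
      refine ⟨j + 1, ?_, by omega, by omega⟩
      by_cases hj1 : w = j + 1
      · subst hj1; simpa using hwU
      rw [mU]
      refine ⟨by omega, by omega, fun h5 => K2 j w (by omega) h1.le (hs _ _ h) h5 h4,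
        fun h5 => K3 j w (by omega) h1 (hs _ _ h) h5 h3⟩
  have Wind : ∀ w ∈ W, ∀ w' ∈ W, ¬ r w w' := by
    intro w hw w' hw' h
    have hw2 := hw'
    rw [mW] at hw2
    obtain ⟨h1, h2, h3, h4⟩ := hw2
    rcases NL w hw w' h1.le h with ⟨u, hu, h5, h6⟩ | ⟨u, hu, h5, h6⟩
    · rw [mU] at hu; subst h6
      exact hu.2.2.2 (by simpa using h4)
    · rw [mU] at hu; subst h6
      rw [Nat.sub_add_cancel hu.2.1] at h3
      exact hu.2.2.1 h3
  have W0 : ∀ w ∈ W, ¬ r w 0 := by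
    intro w hw h
    have := WU w hw
    rw [mU] at this
    exact this.2.2.1 (hs _ _ h)
  -- bound via N(W)
  have L3 : ∀ S : Finset ℕ, 0 < W.card → (∀ j, j ∈ S ↔ j ≤ N ∧ ∃ w ∈ W, r w j) →
      t * (W.card + 1) ≤ S.card := by
    intro S hpos hS
    have h0W : 0 ∉ W := by rw [mW]; omega
    have := hT S (insert 0 W) (fun i => if i ∈ W then i else 0) ?_ ?_ ?_ ?_ ?_
    · rw [Finset.card_insert_of_notMem h0W] at this
      exact_mod_cast this
    · intro i hi
      rw [Finset.mem_insert, mW] at hi; omega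
    · rw [Finset.disjoint_left]
      intro i hi hi2
      rw [hS] at hi
      obtain ⟨_, w, hw, h⟩ := hi
      rcases Finset.mem_insert.1 hi2 with rfl | hi2
      · exact W0 w hw h
      · exact Wind w hw i hi2 h
    · intro i hi j hj hij
      simp only [Finset.coe_insert, Set.mem_insert_iff, Finset.mem_coe] at hi hj
      have hW1 : ∀ i ∈ W, 1 ≤ i := fun i hi => ((mW i).1 hi).2.1
      dsimp only at hij
      grind
    · rw [Finset.card_insert_of_notMem h0W]; omega
    · intro i j hi hj hiS hjS h
      have h1 : i ∉ W := fun hw => hjS ((hS j).2 ⟨hj, i, hw, h⟩)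
      have h2 : j ∉ W := fun hw => hiS ((hS i).2 ⟨hi, j, hw, hs _ _ h⟩)
      simp [h1, h2]
  have L2 : ∀ w ∈ W, ∀ S : Finset ℕ, (∀ j, j ∈ S ↔ j ≤ N ∧ r w j) → t * 2 ≤ S.card := by
    intro w hw S hS
    have hw1 := ((mW w).1 hw)
    have h20 : ({0, w} : Finset ℕ).card = 2 := Finset.card_pair (by omega)
    have := hT S {0, w} (fun i => if i = w then 1 else 0) ?_ ?_ ?_ ?_ ?_
    · rw [h20] at this
      exact_mod_cast this
    · intro i hi
      simp at hi; omega
    · rw [Finset.disjoint_left]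
      intro i hi hi2
      rw [hS] at hi
      simp only [Finset.mem_insert, Finset.mem_singleton] at hi2
      rcases hi2 with rfl | rfl
      · exact W0 w hw hi.2
      · exact hirr _ hi.2
    · intro i hi j hj hij
      simp only [Finset.coe_insert, Set.mem_insert_iff, Finset.coe_singleton, Set.mem_singleton_iff] at hi hj
      dsimp only at hij
      grind
    · exact h20.ge
    · intro i j hi hj hiS hjS h
      have h1 : i ≠ w := by rintro rfl; exact hjS ((hS j).2 ⟨hj, h⟩)
      have h2 : j ≠ w := by rintro rfl; exact hiS ((hS i).2 ⟨hi, hs _ _ h⟩)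
      simp [h1, h2]
  -- the main cut
  have L1 : t * 2 ≤ 2 * W.card + 3 * C.card + 1 := by
    set St := B.filter (fun i => ¬ (1 ≤ i ∧ i - 1 ∈ B)) with hSt
    set En := B.filter (fun i => ¬ (i + 1 ∈ B)) with hEn
    set En1 := B.filter (fun i => i + 1 < N ∧ ¬ (i + 1 ∈ B)) with hEn1
    have e1 : En1.card ≤ W.card + C.card := by
      have : En1.image (· + 1) ⊆ W ∪ C := by
        intro j hj
        simp only [hEn1, Finset.mem_image, Finset.mem_filter, mB] at hj
        obtain ⟨i, ⟨⟨h1, h2⟩, h3, h4⟩, rfl⟩ := hj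
        simp only [Finset.mem_union, mW, mC]
        have : ¬ r N (i+1) := fun h => h4 ⟨h3, h⟩
        by_cases ha : r 0 (i+1+1)
        · left; exact ⟨h3, by omega, ha, h2⟩
        · right; exact ⟨h3, ha, this⟩
      have h1 := Finset.card_le_card this
      rw [Finset.card_image_of_injective _ (add_left_injective 1)] at h1
      exact h1.trans (Finset.card_union_le _ _)
    have e2 : En.card ≤ En1.card + 1 := by
      have : En ⊆ insert (N-1) En1 := by
        intro i hi
        simp only [hEn, hEn1, Finset.mem_insert, Finset.mem_filter] at hi ⊢
        have := ((mB i).1 hi.1).1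
        by_cases h : i = N - 1
        · exact Or.inl h
        · exact Or.inr ⟨hi.1, by omega, hi.2⟩
      exact (Finset.card_le_card this).trans (Finset.card_insert_le _ _)
    have e3 : St.card = En.card := by
      have h1 := Finset.card_filter_add_card_filter_not (s := B) (fun i => (1 ≤ i ∧ i - 1 ∈ B))
      have h2 := Finset.card_filter_add_card_filter_not (s := B) (fun i => (i + 1 ∈ B))
      have h3 : (B.filter (fun i => (1 ≤ i ∧ i - 1 ∈ B))).card = (B.filter (fun i => (i + 1 ∈ B))).card := by
        rw [← Finset.card_image_of_injective (B.filter (fun i => (i + 1 ∈ B))) (add_left_injective 1)]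
        congr 1
        ext i
        simp only [Finset.mem_filter, Finset.mem_image]
        constructor
        · rintro ⟨h1, h2, h3⟩
          exact ⟨i - 1, ⟨h3, by rwa [Nat.sub_add_cancel h2]⟩, by omega⟩
        · rintro ⟨j, ⟨h1, h2⟩, rfl⟩
          exact ⟨h2, by omega, by simpa using h1⟩
      have h1' : (B.filter (fun i => (1 ≤ i ∧ i - 1 ∈ B))).card + St.card = B.card := by
        rw [← h1, hSt]
      have h2' : (B.filter (fun i => (i + 1 ∈ B))).card + En.card = B.card := by
        rw [← h2, hEn]
      omega
    have hS : t * 2 ≤ (C ∪ (St ∪ En1)).card := by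
      have h20 : ({0, N} : Finset ℕ).card = 2 := Finset.card_pair (by omega)
      have h0A : 0 ∈ A := (mA 0).2 ⟨by omega, hp 0 (by omega)⟩
      have hNA : N ∉ A := by rw [mA]; omega
      have key : ∀ s q, s ≤ N → q ≤ N → q ∉ (C ∪ (St ∪ En1)) → r s q → s ∈ A → q ∉ A → False := by
        intro s q hsN hqN hq h hsA hqA
        rw [mA] at hsA
        obtain ⟨h1, h2⟩ := hsA
        rcases Nat.lt_or_ge q N with hlt | hge
        · have hqB : q ∈ B := by
            rw [mB]; by_contra hc
            apply hq
            rw [mA] at hqA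
            simp only [Finset.mem_union, mC]; tauto
          have h3 : 1 ≤ q ∧ q - 1 ∈ B := by
            by_contra hc
            apply hq
            simp only [Finset.mem_union, hSt, Finset.mem_filter]; tauto
          have h4 : q + 1 < N → q + 1 ∈ B := by
            intro hh
            by_contra hc
            apply hq
            simp only [Finset.mem_union, hEn1, Finset.mem_filter]; tauto
          simp only [mB] at h3 h4
          rcases lt_trichotomy s q with hh | rfl | hh
          · by_cases hsq : q = s + 1
            · subst hsq; exact K1 s h1 h2 (by simpa using h3.2.2)
            · exact K2 s q (by omega) hqN h h2 h3.2.2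
          · exact hirr _ h
          · exact K3 q s hh h1 (hs _ _ h) (by
              by_cases hq1 : q + 1 < N
              · exact (h4 hq1).2
              · omega) h2
        · obtain rfl : q = N := by omega
          exact K1 s h1 h2 (hs _ _ h)
      have := hT (C ∪ (St ∪ En1)) {0, N} (fun i => if i ∈ A then 0 else 1) ?_ ?_ ?_ ?_ ?_
      · rw [h20] at this
        exact_mod_cast this
      · intro i hi
        simp at hi; omega
      · rw [Finset.disjoint_left]
        intro i hi hi2
        simp only [Finset.mem_insert, Finset.mem_singleton] at hi2
        simp only [Finset.mem_union, hSt, hEn1, Finset.mem_filter, mC, mB] at hi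
        have : ¬ r N 0 := fun h => h0N (hs _ _ h)
        have h01 := hp 0 (by omega)
        rcases hi2 with rfl | rfl
        · simp only [zero_add] at *; tauto
        · rcases hi with h | h | h <;> omega
      · intro i hi j hj hij
        simp only [Finset.coe_insert, Set.mem_insert_iff, Finset.coe_singleton, Set.mem_singleton_iff] at hi hj
        dsimp only at hij
        grind
      · exact h20.ge
      · intro i j hi hj hiS hjS h
        by_cases h1 : i ∈ A <;> by_cases h2 : j ∈ A <;> simp only [h1, h2, if_true, if_false]
        · exact (key i j hi hj hjS h h1 h2).elim
        · exact (key j i hj hi hiS (hs _ _ h) h2 h1).elim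
    have h1 := Finset.card_union_le C (St ∪ En1)
    have h2 := Finset.card_union_le St En1
    have : (C ∪ (St ∪ En1)).card ≤ 2 * W.card + 3 * C.card + 1 := by omega
    refine hS.trans ?_
    exact_mod_cast this
  have im1 : ∀ X : Finset ℕ, (X.image (· + 1)).card ≤ X.card := fun X => Finset.card_image_le
  have im2 : ∀ X : Finset ℕ, (X.image (· - 1)).card ≤ X.card := fun X => Finset.card_image_le
  apply core_arith t C.card W.card ht
  · have : (A.card + B.card + C.card : ℝ) = N := by exact_mod_cast hcard
    rw [hAc, hBc] at this
    push_cast at hdeg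
    linarith
  · linarith
  · intro hpos
    obtain ⟨w, hw⟩ := Finset.card_pos.1 hpos
    have h1 := L2 w hw ((Finset.range (N+1)).filter (fun j => r w j)) (by simp)
    have h2 : ((Finset.range (N+1)).filter (fun j => r w j)) ⊆
        (U.filter (fun u => w ≤ u)).image (· + 1) ∪ (U.filter (fun u => u ≤ w)).image (· - 1) := by
      intro j hj
      simp only [Finset.mem_filter, Finset.mem_range] at hj
      simp only [Finset.mem_union, Finset.mem_image, Finset.mem_filter]
      rcases NL w hw j (by omega) hj.2 with ⟨u, hu, h5, h6⟩ | ⟨u, hu, h5, h6⟩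
      · left; exact ⟨u, ⟨hu, h5⟩, h6.symm⟩
      · right; exact ⟨u, ⟨hu, h5⟩, h6.symm⟩
    have h3 := Finset.card_le_card h2
    have h4 := Finset.card_union_le ((U.filter (fun u => w ≤ u)).image (· + 1)) ((U.filter (fun u => u ≤ w)).image (· - 1))
    have h5 := im1 (U.filter (fun u => w ≤ u))
    have h6 := im2 (U.filter (fun u => u ≤ w))
    have h7 := Finset.card_union_add_card_inter (U.filter (fun u => w ≤ u)) (U.filter (fun u => u ≤ w))
    have h8 : ((U.filter (fun u => w ≤ u)) ∪ (U.filter (fun u => u ≤ w))).card ≤ U.card := by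
      apply Finset.card_le_card
      intro i; simp only [Finset.mem_union, Finset.mem_filter]; tauto
    have h9 : ((U.filter (fun u => w ≤ u)) ∩ (U.filter (fun u => u ≤ w))).card ≤ ({w} : Finset ℕ).card := by
      apply Finset.card_le_card
      intro i; simp only [Finset.mem_inter, Finset.mem_filter, Finset.mem_singleton]; intro h; omega
    rw [Finset.card_singleton] at h9
    have : ((Finset.range (N+1)).filter (fun j => r w j)).card ≤ W.card + 2 * C.card + 1 := by omega
    have : (((Finset.range (N+1)).filter (fun j => r w j)).card : ℝ) ≤ W.card + 2 * C.card + 1 := by exact_mod_cast this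
    linarith
  · intro hpos
    refine (L3 ((Finset.range (N+1)).filter (fun j => ∃ w ∈ W, r w j)) hpos (by simp)).trans ?_
    have h2 : ((Finset.range (N+1)).filter (fun j => ∃ w ∈ W, r w j)) ⊆
        U.image (· + 1) ∪ U.image (· - 1) := by
      intro j hj
      simp only [Finset.mem_filter, Finset.mem_range] at hj
      obtain ⟨hj, w, hw, h⟩ := hj
      simp only [Finset.mem_union, Finset.mem_image]
      rcases NL w hw j (by omega) h with ⟨u, hu, h5, h6⟩ | ⟨u, hu, h5, h6⟩
      · left; exact ⟨u, hu, h6.symm⟩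
      · right; exact ⟨u, hu, h6.symm⟩
    have h3 := Finset.card_le_card h2
    have h4 := Finset.card_union_le (U.image (· + 1)) (U.image (· - 1))
    have h5 := im1 U
    have h6 := im2 U
    have : ((Finset.range (N+1)).filter (fun j => ∃ w ∈ W, r w j)).card ≤ 2 * W.card + 4 * C.card := by omega
    exact_mod_cast this
  · intro hpos hC1
    set S := ((Finset.range (N+1)).filter (fun j => ∃ w ∈ W, r w j)) with hSdef
    have mS : ∀ j, j ∈ S ↔ j ≤ N ∧ ∃ w ∈ W, r w j := by simp [hSdef]
    refine (L3 S hpos mS).trans ?_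
    suffices S.card ≤ 2 * W.card + 3 by exact_mod_cast this
    obtain ⟨c, hc⟩ := Finset.card_eq_one.1 hC1
    have mc : ∀ i, i < N → ¬ r 0 (i+1) → ¬ r N i → i = c := by
      intro i h1 h2 h3
      have : i ∈ C := (mC i).2 ⟨h1, h2, h3⟩
      rw [hc] at this; simpa using this
    have hcC : c < N ∧ ¬ r 0 (c+1) ∧ ¬ r N c := by rw [← mC, hc]; simp
    -- U ⊆ W ∪ {c, c+1}
    have hUW : ∀ u ∈ U, u ∈ W ∨ u = c ∨ u = c + 1 := by
      intro u hu
      rw [mU] at hu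
      obtain ⟨h1, h2, h3, h4⟩ := hu
      obtain ⟨j, rfl⟩ : ∃ j, u = j + 1 := ⟨u - 1, by omega⟩
      by_cases ha : r 0 (j+1+1)
      · by_cases hb : r N j
        · left; rw [mW]; exact ⟨h1, h2, ha, hb⟩
        · right; right; rw [mc j (by omega) h3 hb]
      · right; left; exact mc _ h1 ha h4
    have big : ∀ X : Finset ℕ, S ⊆ (W.image (· + 1) ∪ W.image (· - 1)) ∪ X → X.card ≤ 3 →
        S.card ≤ 2 * W.card + 3 := by
      intro X h1 h2
      have h3 := Finset.card_le_card h1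
      have h4 := Finset.card_union_le (W.image (· + 1)) (W.image (· - 1))
      have h5 := im1 W
      have h6 := im2 W
      have h7 := Finset.card_union_le (W.image (· + 1) ∪ W.image (· - 1)) X
      omega
    have hS2 : ∀ j ∈ S, ∃ u ∈ U, j = u + 1 ∨ j = u - 1 := by
      intro j hj
      obtain ⟨hj, w, hw, h⟩ := (mS j).1 hj
      rcases NL w hw j hj h with ⟨u, hu, h5, h6⟩ | ⟨u, hu, h5, h6⟩
      · exact ⟨u, hu, Or.inl h6⟩
      · exact ⟨u, hu, Or.inr h6⟩
    have mWW : ∀ j u, u ∈ W → (j = u + 1 ∨ j = u - 1) → j ∈ W.image (· + 1) ∪ W.image (· - 1) := by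
      intro j u hu h
      simp only [Finset.mem_union, Finset.mem_image]
      rcases h with h | h
      · left; exact ⟨u, hu, h.symm⟩
      · right; exact ⟨u, hu, h.symm⟩
    have one : ∀ z, (∀ u ∈ U, u ∈ W ∨ u = z) → S.card ≤ 2 * W.card + 3 := by
      intro z hz
      apply big {z+1, z-1} _ (by have := Finset.card_le_two (a := z+1) (b := z-1); omega)
      intro j hj
      obtain ⟨u, hu, h⟩ := hS2 j hj
      rw [Finset.mem_union]
      rcases hz u hu with h1 | rfl
      · left; exact mWW j u h1 h
      · right; simpa using h
    by_cases hcU : c ∈ U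
    swap
    · apply one (c+1)
      intro u hu
      rcases hUW u hu with h | h | h
      · exact Or.inl h
      · exact absurd (h ▸ hu) hcU
      · exact Or.inr h
    by_cases hcU1 : c + 1 ∈ U
    swap
    · apply one c
      intro u hu
      rcases hUW u hu with h | h | h
      · exact Or.inl h
      · exact Or.inr h
      · exact absurd (h ▸ hu) hcU1
    have four : ∀ j ∈ S, j ∈ W.image (· + 1) ∪ W.image (· - 1) ∨ j = c - 1 ∨ j = c ∨ j = c + 1 ∨ j = c + 2 := by
      intro j hj
      obtain ⟨u, hu, h⟩ := hS2 j hj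
      rcases hUW u hu with h1 | rfl | rfl
      · left; exact mWW j u h1 h
      · right; omega
      · right; omega
    have hnot : ¬ (c ∈ S ∧ c + 1 ∈ S) := by
      rintro ⟨ha, hb⟩
      obtain ⟨_, w, hw, h⟩ := (mS _).1 ha
      obtain ⟨_, w', hw', h'⟩ := (mS _).1 hb
      have hw1 := (mW w).1 hw
      have hw1' := (mW w').1 hw'
      rw [mU] at hcU hcU1
      have hcb : r N (c-1) := by
        by_contra hcon
        have := mc (c-1) (by omega) (by rw [Nat.sub_add_cancel hcU.2.1]; exact hcU.2.2.1) hcon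
        omega
      have hca : r 0 (c+1+1) := by
        by_contra hcon
        have := mc (c+1) (by omega) hcon hcU1.2.2.2
        omega
      have g1 : c + 2 ≤ w := by
        rcases NL w hw c (by omega) h with ⟨u, hu, h5, h6⟩ | ⟨u, hu, h5, h6⟩
        · exfalso; rw [mU] at hu
          apply hu.2.2.2
          rw [h6] at hcb; simpa using hcb
        · rw [mU] at hu
          have : w ≠ c + 1 := by
            rintro rfl
            exact hcC.2.2 (by simpa using hw1.2.2.2)
          omega
      have g2 : w' < c := by
        rcases NL w' hw' (c+1) (by omega) h' with ⟨u, hu, h5, h6⟩ | ⟨u, hu, h5, h6⟩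
        · have : w' ≠ c := by
            rintro rfl
            exact hcC.2.1 hw1'.2.2.1
          omega
        · exfalso; rw [mU] at hu
          apply hu.2.2.1
          have : u = c + 1 + 1 := by omega
          rw [this]; exact hca
      exact K5 w' c w g2 g1 hw1.1.le h' h hw1'.2.2.1 hw1.2.2.2
    by_cases hcS : c ∈ S
    · have hn : c + 1 ∉ S := fun h => hnot ⟨hcS, h⟩
      apply big {c-1, c, c+2} _ Finset.card_le_three
      intro j hj
      rw [Finset.mem_union]
      have hne : j ≠ c + 1 := by rintro rfl; exact hn hj
      rcases four j hj with h | h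
      · exact Or.inl h
      · right; simp only [Finset.mem_insert, Finset.mem_singleton]; omega
    · apply big {c-1, c+1, c+2} _ Finset.card_le_three
      intro j hj
      rw [Finset.mem_union]
      have hne : j ≠ c := by rintro rfl; exact hcS hj
      rcases four j hj with h | h
      · exact Or.inl h
      · right; simp only [Finset.mem_insert, Finset.mem_singleton]; omega

theorem tough_color {V : Type*} [Fintype V] (t : ℝ) (ht : 0 ≤ t) (G : SimpleGraph V) (h : Tough t G)
    (S T : Finset V) (f : V → ℕ) (hd : Disjoint S T) (hf : Set.InjOn f (T : Set V)) (hT : 2 ≤ T.card)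
    (hc : ∀ u v, u ∉ S → v ∉ S → G.Adj u v → f u = f v) : t * T.card ≤ S.card := by
  classical
  set H := G.induce ((↑S : Set V)ᶜ) with hH
  have hr : ∀ a b : ((↑S : Set V)ᶜ : Set V), H.Reachable a b → f a = f b := by
    rintro a b ⟨p⟩
    induction p with
    | nil => rfl
    | @cons u v w hadj _ ih =>
      rw [← ih]
      exact hc _ _ u.2 v.2 hadj
  have hm : ∀ a ∈ T, a ∈ ((↑S : Set V)ᶜ : Set V) := by
    intro a ha; simpa using Finset.disjoint_right.1 hd ha
  let g : T → H.ConnectedComponent := fun a => H.connectedComponentMk ⟨a.1, hm _ a.2⟩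
  have hg : Function.Injective g := by
    intro a b hab
    have := hr _ _ (ConnectedComponent.exact hab)
    exact Subtype.ext (hf a.2 b.2 this)
  have h1 : T.card ≤ Nat.card H.ConnectedComponent := by
    have := Nat.card_le_card_of_injective g hg
    simpa using this
  have h2 : ¬ H.Connected := by
    intro hcon
    have : Nat.card H.ConnectedComponent ≤ 1 := by
      have := hcon.preconnected.subsingleton_connectedComponent
      exact Finite.card_le_one_iff_subsingleton.2 this
    omega
  have h3 := h S h2
  refine le_trans ?_ h3
  gcongr

theorem ham_of_list {V : Type*} [Fintype V] [DecidableEq V] (G : SimpleGraph V)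
    (h3 : 3 ≤ Fintype.card V)
    (l : List V) (hn : l.Nodup) (hl : l.length = Fintype.card V) (hch : l.IsChain G.Adj)
    (hcl : ∀ a ∈ l.head?, ∀ b ∈ l.getLast?, G.Adj b a) : G.IsHamiltonian := by
  intro _
  have hne : l ≠ [] := by rintro rfl; simp at hl; omega
  set q := Walk.ofSupport l hne hch with hq
  have hsup : q.support = l := Walk.support_ofSupport hne hch
  have hlen : q.length + 1 = l.length := by
    have := congrArg List.length hsup
    rwa [Walk.length_support] at this
  have hp : q.IsPath := by rw [Walk.isPath_def, hsup]; exact hn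
  have hadj : G.Adj (l.getLast hne) (l.head hne) :=
    hcl _ (List.head_mem_head? hne) _ (List.getLast_mem_getLast? hne)
  refine ⟨_, Walk.cons hadj q, ?_⟩
  rw [Walk.isHamiltonianCycle_iff_isCycle_and_length_eq]
  refine ⟨?_, by rw [Walk.length_cons]; omega⟩
  rw [Walk.cons_isCycle_iff]
  refine ⟨hp, fun he => ?_⟩
  have := hp.length_eq_one_of_mem_edges (by rwa [Sym2.eq_swap] at he)
  omega

theorem periodic_of_ham {V : Type*} [Fintype V] [DecidableEq V] (G : SimpleGraph V)
    (h3 : 3 ≤ Fintype.card V) (h : G.IsHamiltonian) :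
    ∃ f : ℕ → V, (∀ i, f (i + Fintype.card V) = f i) ∧ (∀ i, G.Adj (f i) (f (i+1))) ∧
      (∀ i j, f i = f j → i % Fintype.card V = j % Fintype.card V) := by
  obtain ⟨a, c, hc⟩ := h (by omega)
  have hl := hc.length_eq
  set n := Fintype.card V
  refine ⟨fun i => c.getVert (i % n), ?_, ?_, ?_⟩
  · intro i; simp
  · intro i
    have hi : i % n < n := Nat.mod_lt _ (by omega)
    have hadj := c.adj_getVert_succ (i := i % n) (by omega)
    have : c.getVert ((i+1) % n) = c.getVert (i % n + 1) := by
      rw [Nat.add_mod, Nat.mod_eq_of_lt (show 1 < n by omega)]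
      rcases Nat.lt_or_ge (i % n + 1) n with h1 | h1
      · rw [Nat.mod_eq_of_lt h1]
      · have : i % n + 1 = n := by omega
        rw [this, Nat.mod_self, Walk.getVert_zero, ← hl, Walk.getVert_length]
    dsimp only
    rw [this]; exact hadj
  · intro i j hij
    have hi : i % n < n := Nat.mod_lt _ (by omega)
    have hj : j % n < n := Nat.mod_lt _ (by omega)
    apply hc.isCycle.getVert_injOn' _ _ hij
    · rw [Set.mem_ofPred_eq]; omega
    · rw [Set.mem_ofPred_eq]; omega

theorem path_core {V : Type*} [Fintype V] [DecidableEq V] (t : ℝ) (ht : 5 / 2 ≤ t)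
    (G : SimpleGraph V) [DecidableRel G.Adj] (htough : Tough t G) (N : ℕ) (hN : 2 ≤ N)
    (hcard : Fintype.card V = N + 1) (p : ℕ → V)
    (hinj : ∀ i j, i ≤ N → j ≤ N → p i = p j → i = j)
    (hadj : ∀ i, i < N → G.Adj (p i) (p (i+1)))
    (hnadj : ¬ G.Adj (p 0) (p N))
    (hdeg : (Fintype.card V : ℝ) - (2 * t + 1) / 3 ≤ G.degree (p 0) + G.degree (p N))
    (hham : ¬ G.IsHamiltonian) : False := by
  have hinjOn : Set.InjOn p ((Finset.range (N+1) : Finset ℕ) : Set ℕ) := by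
    intro i hi j hj h
    simp at hi hj
    exact hinj i j (by omega) (by omega) h
  have himg : (Finset.range (N+1)).image p = Finset.univ := by
    rw [← Finset.card_eq_iff_eq_univ, Finset.card_image_of_injOn hinjOn, hcard, Finset.card_range]
  have hsurj : ∀ v, ∃ i, i ≤ N ∧ p i = v := by
    intro v
    have : v ∈ (Finset.range (N+1)).image p := by rw [himg]; simp
    simp only [Finset.mem_image, Finset.mem_range] at this
    obtain ⟨i, hi, h⟩ := this
    exact ⟨i, by omega, h⟩
  choose idx hidx1 hidx2 using hsurj
  have hidx3 : ∀ i, i ≤ N → idx (p i) = i := fun i hi => hinj _ _ (hidx1 _) hi (hidx2 _)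
  have hK := dn_cycles N (fun i j => G.Adj (p i) (p j)) (fun i j h => h.symm) hadj (by
    intro l h1 h2 h3 h4 h5
    apply hham
    apply ham_of_list G (by omega) (l.map p)
    · apply List.Nodup.map_on _ h1
      intro i hi j hj h
      exact hinj i j (h3 i hi) (h3 j hj) h
    · simp [h2, hcard]
    · rw [List.isChain_map]; exact h4
    · rw [List.head?_map, List.getLast?_map]
      intro a ha b hb
      simp only [Option.mem_def, Option.map_eq_some_iff] at ha hb
      obtain ⟨a', ha', rfl⟩ := ha
      obtain ⟨b', hb', rfl⟩ := hb
      exact h5 a' ha' b' hb')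
  obtain ⟨K1, K2, K3, K4, K5⟩ := hK
  have hd : ∀ k, k ≤ N → ∀ T : Finset ℕ, (∀ i, i ∈ T ↔ i ≤ N ∧ G.Adj (p k) (p i)) → T.card = G.degree (p k) := by
    intro k hk T hT
    rw [← G.card_neighborFinset_eq_degree, ← Finset.card_image_of_injOn (s := T) (f := p)]
    · congr 1
      ext v
      simp only [Finset.mem_image, mem_neighborFinset, hT]
      constructor
      · rintro ⟨i, ⟨_, h⟩, rfl⟩; exact h
      · intro h
        exact ⟨idx v, ⟨hidx1 v, by rwa [hidx2]⟩, hidx2 v⟩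
    · intro i hi j hj h
      exact hinj i j ((hT i).1 hi).1 ((hT j).1 hj).1 h
  refine core_comb N hN (fun i j => G.Adj (p i) (p j)) t ht (fun i j h => h.symm) (fun i h => G.irrefl h)
    hadj hnadj K1 K2 K3 K4 K5 ?_ (G.degree (p 0)) (G.degree (p N)) (hd 0 (by omega)) (hd N le_rfl)
    (by rw [← hcard]; exact hdeg)
  intro S T f hTN hdis hf h2 hcol
  have hTc : (T.image p).card = T.card := by
    apply Finset.card_image_of_injOn
    intro i hi j hj h
    exact hinj i j (hTN i hi) (hTN j hj) h
  have := tough_color t (by linarith) G htough ((S.filter (fun i => i ≤ N)).image p) (T.image p) (fun v => f (idx v)) ?_ ?_ ?_ ?_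
  · rw [hTc] at this
    refine this.trans ?_
    have h1 : ((S.filter (fun i => i ≤ N)).image p).card ≤ S.card :=
      Finset.card_image_le.trans (Finset.card_filter_le _ _)
    exact_mod_cast h1
  · rw [Finset.disjoint_left]
    intro v hv hv2
    simp only [Finset.mem_image, Finset.mem_filter] at hv hv2
    obtain ⟨i, ⟨hi, hiN⟩, rfl⟩ := hv
    obtain ⟨j, hj, h⟩ := hv2
    rw [hinj j i (hTN j hj) hiN h] at hj
    exact Finset.disjoint_left.1 hdis hi hj
  · intro u hu v hv h
    simp only [Finset.coe_image, Set.mem_image, Finset.mem_coe] at hu hv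
    obtain ⟨i, hi, rfl⟩ := hu
    obtain ⟨j, hj, rfl⟩ := hv
    dsimp only at h
    rw [hidx3 i (hTN i hi), hidx3 j (hTN j hj)] at h
    rw [hf hi hj h]
  · rw [hTc]; exact h2
  · intro u v hu hv h
    have aux : ∀ u, u ∉ (S.filter (fun i => i ≤ N)).image p → idx u ∉ S := by
      intro u hu h
      apply hu
      simp only [Finset.mem_image, Finset.mem_filter]
      exact ⟨idx u, ⟨h, hidx1 u⟩, hidx2 u⟩
    apply hcol _ _ (hidx1 u) (hidx1 v) (aux u hu) (aux v hv)
    rw [hidx2, hidx2]; exact h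

theorem stmt_6 {V : Type*} [Fintype V] [DecidableEq V]
    (t' : ℝ) (ht' : 5 / 2 ≤ t')
    (hn : 3 ≤ Fintype.card V)
    (G : SimpleGraph V) [DecidableRel G.Adj]
    (htough : Tough t' G)
    (x y : V) (hxy : x ≠ y) (hnadj : ¬ G.Adj x y)
    (hdeg : (Fintype.card V : ℝ) - (2 * t' + 1) / 3 ≤ G.degree x + G.degree y) :
    G.IsHamiltonian ↔ (G ⊔ fromEdgeSet {s(x, y)}).IsHamiltonian := by
  refine ⟨fun h => h.mono le_sup_left, fun h => ?_⟩
  by_contra hham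
  obtain ⟨f, hper, hadj, hinj⟩ := periodic_of_ham _ hn h
  obtain ⟨N, hN⟩ : ∃ N, Fintype.card V = N + 1 := ⟨Fintype.card V - 1, by omega⟩
  rw [hN] at hper hinj
  have hadj' : ∀ i, G.Adj (f i) (f (i+1)) ∨ (f i = x ∧ f (i+1) = y) ∨ (f i = y ∧ f (i+1) = x) := by
    intro i
    have := hadj i
    simp only [sup_adj, fromEdgeSet_adj, Set.mem_singleton_iff, Sym2.eq_iff] at this
    tauto
  have hmod : ∀ k i j, i ≤ N → j ≤ N → f (k + i) = f (k + j) → i = j := by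
    intro k i j hi hj h
    have h1 : k + i ≡ k + j [MOD (N+1)] := hinj _ _ h
    have h2 := Nat.ModEq.add_left_cancel' k h1
    exact Nat.ModEq.eq_of_lt_of_lt h2 (by omega) (by omega)
  by_cases hall : ∀ i, G.Adj (f i) (f (i+1))
  · apply hham
    apply ham_of_list G hn ((List.range (N+1)).map f)
    · apply List.Nodup.map_on _ List.nodup_range
      intro i hi j hj h
      simp only [List.mem_range] at hi hj
      exact hmod 0 i j (by omega) (by omega) (by simpa using h)
    · simp [hN]
    · rw [List.isChain_map, List.isChain_iff_getElem]
      intro i hi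
      simpa using hall i
    · intro a ha b hb
      have h1 : a = f 0 := by simpa [List.head?_range] using ha.symm
      have h2 : b = f N := by simpa [List.getLast?_range] using hb.symm
      have h3 := hall N
      have h4 := hper 0
      rw [zero_add] at h4
      rw [h4] at h3
      rw [h1, h2]; exact h3
  · push Not at hall
    obtain ⟨k, hk⟩ := hall
    have hk' := (hadj' k).resolve_left hk
    have e0 : f (k + 1 + N) = f k := by rw [← hper k]; congr 1; omega
    have hnx : ¬ G.Adj (f (k+1)) (f k) := fun h => hk h.symm
    apply path_core t' ht' G htough N (by omega) hN (fun i => f (k + 1 + i)) (hmod (k+1))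
    · intro i hi
      have h1 := hadj' (k + 1 + i)
      rcases h1 with h1 | h1
      · exact h1
      exfalso
      have h2 : f (k+1+i) = f (k+1+0) ∨ f (k+1+i) = f (k+1+N) := by
        rw [e0, add_zero]
        rcases h1 with h1 | h1 <;> rcases hk' with h3 | h3 <;> simp [h1, h3]
      rcases h2 with h2 | h2
      · have := hmod (k+1) i 0 (by omega) (by omega) h2
        subst this
        have h4 : f (k+1+1) = f (k+1+N) := by
          rw [e0]
          rw [add_zero] at h1
          rcases h1 with h1 | h1 <;> rcases hk' with h3 | h3
          · exact absurd (h1.1.symm.trans h3.2) hxy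
          · rw [h1.2, h3.1]
          · rw [h1.2, h3.1]
          · exact absurd (h3.2.symm.trans h1.1) hxy
        have := hmod (k+1) 1 N (by omega) (by omega) h4
        omega
      · have := hmod (k+1) i N (by omega) (by omega) h2
        omega
    · try dsimp only
      rw [e0, add_zero]; exact hnx
    · try dsimp only
      rw [e0, add_zero]
      rcases hk' with h3 | h3
      · rw [h3.1, h3.2, add_comm (G.degree y : ℝ)]; exact hdeg
      · rw [h3.1, h3.2]; exact hdeg
    · exact hham
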